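/- Let n ≥ 4 and suppose g, h ∈ C^∞_0(R^n). Then for every R > 0, ||g h||_{L^2(R ≤ |x| ≤ 2R)} ≤ C Σ_{|α| ≤ (n+1)/2} || |x|^{-(n-2)/4} Ω^α g ||_{L^2(R ≤ |x| ≤ 2R)} · || |x|^{-(n-2)/4} ∇h ||_{L^2(|x| > R)}, where Ω^α ranges over products of at most ⌈(n+1)/2⌉ rotation vector fields Ω_{ij} = x_i∂_j − x_j∂_i. -/

import Mathlib

open MeasureTheory Real

/-- Partial derivative `∂_i f` on `ℝⁿ`. -/
noncomputable def pd (n : ℕ) (i : Fin n) (f : EuclideanSpace ℝ (Fin n) → ℝ) :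
    EuclideanSpace ℝ (Fin n) → ℝ :=
  fun x => fderiv ℝ f x (EuclideanSpace.single i 1)

/-- Rotation vector field `Ω_{ij} f = x_i ∂_j f − x_j ∂_i f` on `ℝⁿ`. -/
noncomputable def rot (n : ℕ) (i j : Fin n) (f : EuclideanSpace ℝ (Fin n) → ℝ) :
    EuclideanSpace ℝ (Fin n) → ℝ :=
  fun x => x i * pd n j f x - x j * pd n i f x

/-- The product `Ω^α f` of the rotation fields listed by the word `w`. -/
noncomputable def rotWord (n : ℕ) {l : ℕ} (w : Fin l → Fin n × Fin n)
    (f : EuclideanSpace ℝ (Fin n) → ℝ) : EuclideanSpace ℝ (Fin n) → ℝ :=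
  (List.ofFn w).foldr (fun p g => rot n p.1 p.2 g) f

/-- Words all of whose letters are rotation indices `i < j`. -/
noncomputable def rotWords (n l : ℕ) : Finset (Fin l → Fin n × Fin n) :=
  Finset.univ.filter (fun w => ∀ k, (w k).1 < (w k).2)

section

open scoped ENNReal FourierTransform LineDeriv SchwartzMap

theorem lintegral_mul_sq_le {α : Type*} [MeasurableSpace α] (μ : Measure α) {f g : α → ℝ≥0∞}
    (hf : AEMeasurable f μ) (hg : AEMeasurable g μ) :
    (∫⁻ x, f x * g x ∂μ) ^ 2 ≤ (∫⁻ x, f x ^ 2 ∂μ) * ∫⁻ x, g x ^ 2 ∂μ := by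
  have h := ENNReal.lintegral_mul_le_Lp_mul_Lq μ Real.HolderConjugate.two_two hf hg
  calc (∫⁻ x, f x * g x ∂μ) ^ 2
      ≤ ((∫⁻ x, f x ^ (2 : ℝ) ∂μ) ^ (1 / (2 : ℝ)) *
          (∫⁻ x, g x ^ (2 : ℝ) ∂μ) ^ (1 / (2 : ℝ))) ^ 2 := by
        gcongr
        exact h
    _ = _ := by
        rw [mul_pow, ← ENNReal.rpow_natCast, ← ENNReal.rpow_natCast, ← ENNReal.rpow_mul,
          ← ENNReal.rpow_mul]
        norm_num

theorem SchwartzMap.lintegral_enorm_sq_fourier {V : Type*} [NormedAddCommGroup V]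
    [InnerProductSpace ℝ V] [FiniteDimensional ℝ V] [MeasurableSpace V] [BorelSpace V]
    (U : 𝓢(V, ℂ)) : ∫⁻ ξ, ‖𝓕 U ξ‖ₑ ^ 2 = ∫⁻ x, ‖U x‖ₑ ^ 2 := by
  have key : ∀ W : 𝓢(V, ℂ), ∫⁻ x, ‖W x‖ₑ ^ 2 = ENNReal.ofReal (∫ x, ‖W x‖ ^ 2) := by
    intro W
    rw [ofReal_integral_eq_lintegral_ofReal (f := fun x => ‖W x‖ ^ 2)
      ((W.memLp 2).integrable_norm_pow (by norm_num))
      (.of_forall fun x => by positivity)]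
    simp [ENNReal.ofReal_pow]
  rw [key, key, SchwartzMap.integral_norm_sq_fourier]

theorem one_add_norm_sq_pow_le (n m : ℕ) (hm : 1 ≤ m) (ξ : EuclideanSpace ℝ (Fin n)) :
    (1 + ‖ξ‖ ^ 2) ^ m ≤ 2 ^ (m - 1) * (1 + n ^ (m - 1)) * (1 + ∑ i, (|ξ i| ^ m) ^ 2) := by
  have h1 : (1 + ‖ξ‖ ^ 2) ^ m ≤ 2 ^ (m - 1) * (1 ^ m + (‖ξ‖ ^ 2) ^ m) :=
    add_pow_le (by norm_num) (by positivity) m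
  have h2 : (‖ξ‖ ^ 2) ^ m ≤ n ^ (m - 1) * ∑ i, (|ξ i| ^ m) ^ 2 := by
    obtain ⟨k, rfl⟩ : ∃ k, m = k + 1 := ⟨m - 1, by omega⟩
    rw [EuclideanSpace.norm_sq_eq]
    have h := pow_sum_div_card_le_sum_pow (s := Finset.univ) (f := fun i => ‖ξ i‖ ^ 2) (n := k)
      (fun i _ => by positivity)
    simp only [Finset.card_univ, Fintype.card_fin] at h
    simp only [Real.norm_eq_abs] at h ⊢
    rw [add_tsub_cancel_right]
    simp_rw [← pow_mul, mul_comm _ 2, pow_mul] at h ⊢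
    rcases Nat.eq_zero_or_pos n with rfl | hn
    · simp
    · rwa [div_le_iff₀ (by positivity), mul_comm] at h
  have h3 : 0 ≤ ∑ i, (|ξ i| ^ m) ^ 2 := by positivity
  calc _ ≤ _ := h1
    _ ≤ 2 ^ (m - 1) * (1 + n ^ (m - 1) * ∑ i, (|ξ i| ^ m) ^ 2) := by
        rw [one_pow]; gcongr
    _ ≤ _ := by
        rw [mul_assoc]
        gcongr
        nlinarith [show (0:ℝ) ≤ n ^ (m - 1) by positivity]

theorem SchwartzMap.norm_fourier_iterate_lineDeriv {n : ℕ} (i : Fin n) (m : ℕ)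
    (U : 𝓢(EuclideanSpace ℝ (Fin n), ℂ)) (ξ : EuclideanSpace ℝ (Fin n)) :
    ‖𝓕 ((fun W : 𝓢(EuclideanSpace ℝ (Fin n), ℂ) =>
      (∂_{EuclideanSpace.single i (1:ℝ)} W))^[m] U) ξ‖ = (2 * π * |ξ i|) ^ m * ‖𝓕 U ξ‖ := by
  induction m with
  | zero => simp
  | succ m ih =>
    have : (inner ℝ · (EuclideanSpace.single i (1:ℝ)) :
      EuclideanSpace ℝ (Fin n) → ℝ).HasTemperateGrowth := by fun_prop
    rw [Function.iterate_succ_apply', SchwartzMap.fourier_lineDerivOp_eq, smul_apply,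
      SchwartzMap.smulLeftCLM_apply_apply this, norm_smul, norm_smul, ih]
    simp [EuclideanSpace.inner_single_right, abs_of_pos pi_pos]
    ring

theorem SchwartzMap.exists_enorm_sq_le {n m : ℕ} (hnm : n < 2 * m) :
    ∃ C : ℝ≥0∞, C ≠ ⊤ ∧ ∀ (U : 𝓢(EuclideanSpace ℝ (Fin n), ℂ)) (x : EuclideanSpace ℝ (Fin n)),
      ‖U x‖ₑ ^ 2 ≤ C * ((∫⁻ y, ‖U y‖ₑ ^ 2) + ∑ i : Fin n, ∫⁻ y,
        ‖((fun W : 𝓢(EuclideanSpace ℝ (Fin n), ℂ) =>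
      (∂_{EuclideanSpace.single i (1:ℝ)} W))^[m] U) y‖ₑ ^ 2) := by
  set K : ℝ := 2 ^ (m - 1) * (1 + n ^ (m - 1)) with hK
  have hK0 : 0 ≤ K := by positivity
  set J : ℝ≥0∞ := ∫⁻ ξ : EuclideanSpace ℝ (Fin n),
    ENNReal.ofReal ((1 + ‖ξ‖ ^ 2) ^ (-(m:ℝ) / 2)) ^ 2 with hJ
  have hJt : J ≠ ⊤ := by
    have := (integrable_rpow_neg_one_add_norm_sq (E := EuclideanSpace ℝ (Fin n)) (μ := volume)
      (r := 2 * m) (by simp; exact_mod_cast hnm)).lintegral_lt_top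
    rw [hJ]
    convert this.ne using 3 with ξ
    rw [← ENNReal.ofReal_pow (by positivity), ← Real.rpow_mul_natCast (by positivity)]
    congr 2
    push_cast
    ring
  refine ⟨J * ENNReal.ofReal K, ENNReal.mul_ne_top hJt ENNReal.ofReal_ne_top, fun U x => ?_⟩
  set f : EuclideanSpace ℝ (Fin n) → ℝ≥0∞ := fun ξ => ENNReal.ofReal ((1 + ‖ξ‖ ^ 2) ^ (-(m:ℝ) / 2))
  set g : EuclideanSpace ℝ (Fin n) → ℝ≥0∞ :=
    fun ξ => ENNReal.ofReal ((1 + ‖ξ‖ ^ 2) ^ ((m:ℝ) / 2)) * ‖𝓕 U ξ‖ₑ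
  have hfm : Measurable f := by fun_prop
  have hgm : Measurable g := by
    have := (𝓕 U).continuous.measurable
    fun_prop
  have h1 : ‖U x‖ₑ ≤ ∫⁻ ξ, f ξ * g ξ := by
    have hU : U x = ∫ v, 𝐞 (inner ℝ v x) • 𝓕 U v := by
      rw [← Real.fourierInv_eq, ← SchwartzMap.fourierInv_coe,
        FourierTransform.fourierInv_fourier_eq]
    rw [hU]
    refine (enorm_integral_le_lintegral_enorm _).trans (lintegral_mono fun ξ => ?_)
    simp only [f, g]
    rw [← mul_assoc, ← ENNReal.ofReal_mul (by positivity), ← Real.rpow_add (by positivity)]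
    rw [neg_div, neg_add_cancel, Real.rpow_zero, ENNReal.ofReal_one, one_mul, ← ofReal_norm,
      ← ofReal_norm, Circle.norm_smul]
  have h2 : ∫⁻ ξ, g ξ ^ 2 ≤ ENNReal.ofReal K * ((∫⁻ y, ‖U y‖ₑ ^ 2) + ∑ i : Fin n, ∫⁻ y,
        ‖((fun W : 𝓢(EuclideanSpace ℝ (Fin n), ℂ) =>
      (∂_{EuclideanSpace.single i (1:ℝ)} W))^[m] U) y‖ₑ ^ 2) := by
    rw [← SchwartzMap.lintegral_enorm_sq_fourier U,
      Finset.sum_congr rfl fun i _ => (SchwartzMap.lintegral_enorm_sq_fourier _).symm]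
    have hmeas : ∀ W : 𝓢(EuclideanSpace ℝ (Fin n), ℂ), Measurable fun ξ => ‖W ξ‖ₑ ^ 2 := by
      intro W
      have := W.continuous.measurable
      fun_prop
    rw [← lintegral_finsetSum _ fun i _ => hmeas _, ← lintegral_add_left (hmeas _),
      ← lintegral_const_mul' _ _ ENNReal.ofReal_ne_top]
    refine lintegral_mono fun ξ => ?_
    simp only [g]
    simp_rw [← ofReal_norm, SchwartzMap.norm_fourier_iterate_lineDeriv]
    rw [← ENNReal.ofReal_mul (by positivity), ← ENNReal.ofReal_pow (by positivity)]
    simp_rw [← ENNReal.ofReal_pow (norm_nonneg (𝓕 U ξ))]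
    have : ∀ i, ENNReal.ofReal ((2 * π * |ξ i|) ^ m * ‖𝓕 U ξ‖) ^ 2 =
        ENNReal.ofReal (((2 * π * |ξ i|) ^ m * ‖𝓕 U ξ‖) ^ 2) :=
      fun i => (ENNReal.ofReal_pow (by positivity) _).symm
    simp_rw [this]
    rw [← ENNReal.ofReal_sum_of_nonneg (fun i _ => by positivity),
      ← ENNReal.ofReal_add (by positivity) (by positivity), ← ENNReal.ofReal_mul hK0]
    apply ENNReal.ofReal_le_ofReal
    rw [mul_pow, ← Real.rpow_mul_natCast (by positivity)]
    have e : ((m:ℝ) / 2 * (2:ℕ)) = (m:ℕ) := by push_cast; ring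
    rw [e, Real.rpow_natCast]
    refine (mul_le_mul_of_nonneg_right (one_add_norm_sq_pow_le n m (by omega) ξ)
      (by positivity)).trans ?_
    rw [← hK, mul_assoc]
    gcongr
    rw [add_mul, one_mul, Finset.sum_mul]
    gcongr with i
    rw [← mul_pow]
    gcongr
    nlinarith [abs_nonneg (ξ i), pi_gt_three]
  calc ‖U x‖ₑ ^ 2 ≤ (∫⁻ ξ, f ξ * g ξ) ^ 2 := by gcongr
    _ ≤ J * ∫⁻ ξ, g ξ ^ 2 := lintegral_mul_sq_le _ hfm.aemeasurable hgm.aemeasurable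
    _ ≤ _ := by
      rw [mul_assoc]
      gcongr

theorem exists_enorm_sq_le_iterate_pd {n m : ℕ} (hnm : n < 2 * m) :
    ∃ C : ℝ≥0∞, C ≠ ⊤ ∧ ∀ u : EuclideanSpace ℝ (Fin n) → ℝ, ContDiff ℝ (⊤ : ℕ∞) u →
      HasCompactSupport u → ∀ x,
      ‖u x‖ₑ ^ 2 ≤ C * ((∫⁻ y, ‖u y‖ₑ ^ 2) + ∑ i : Fin n, ∫⁻ y, ‖(pd n i)^[m] u y‖ₑ ^ 2) := by
  obtain ⟨C, hC, h⟩ := SchwartzMap.exists_enorm_sq_le hnm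
  refine ⟨C, hC, fun u hu hc x => ?_⟩
  have hc' : HasCompactSupport (fun x => (u x : ℂ)) := hc.comp_left (g := Complex.ofReal) rfl
  set U : 𝓢(EuclideanSpace ℝ (Fin n), ℂ) :=
    hc'.toSchwartzMap (Complex.ofRealCLM.contDiff.comp hu)
  have hU : ∀ x, U x = u x := fun x => rfl
  have hit : ∀ (i : Fin n) (k : ℕ), ContDiff ℝ (⊤ : ℕ∞) ((pd n i)^[k] u) ∧
      ∀ y, ((fun W : 𝓢(EuclideanSpace ℝ (Fin n), ℂ) =>
      (∂_{EuclideanSpace.single i (1:ℝ)} W))^[k] U) y = ((pd n i)^[k] u y : ℝ) := by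
    intro i k
    induction k with
    | zero => exact ⟨hu, hU⟩
    | succ k ih =>
      simp only [Function.iterate_succ_apply']
      refine ⟨(ih.1.fderiv_right (m := (⊤ : ℕ∞)) (by simp)).clm_apply contDiff_const, fun y => ?_⟩
      rw [SchwartzMap.lineDerivOp_apply_eq_fderiv]
      have e : (((fun W : 𝓢(EuclideanSpace ℝ (Fin n), ℂ) =>
        (∂_{EuclideanSpace.single i (1:ℝ)} W))^[k] U : 𝓢(EuclideanSpace ℝ (Fin n), ℂ)) :
          EuclideanSpace ℝ (Fin n) → ℂ) = fun y => (((pd n i)^[k] u y : ℝ) : ℂ) := funext ih.2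
      rw [e]
      have hd : DifferentiableAt ℝ ((pd n i)^[k] u) y := (ih.1.differentiable (by simp)) y
      have := (Complex.ofRealCLM.hasFDerivAt.comp y hd.hasFDerivAt).fderiv
      simp only [Function.comp_def, Complex.ofRealCLM_apply] at this
      rw [this]
      rfl
  have := h U x
  have hre : ∀ r : ℝ, ‖(r : ℂ)‖ₑ = ‖r‖ₑ := fun r => by simp [← ofReal_norm]
  simpa only [hU, (hit _ _).2, hre] using this

theorem lintegral_eq_lintegral_sphere_prod {n : ℕ} (hn : 0 < n)
    (f : EuclideanSpace ℝ (Fin n) → ℝ≥0∞) :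
    ∫⁻ x, f x = ∫⁻ z, f ((z.2 : ℝ) • (z.1 : EuclideanSpace ℝ (Fin n)))
      ∂((volume : Measure (EuclideanSpace ℝ (Fin n))).toSphere.prod
        (Measure.volumeIoiPow (n - 1))) := by
  have : Nonempty (Fin n) := ⟨⟨0, hn⟩⟩
  have h := (volume : Measure (EuclideanSpace ℝ (Fin n))).measurePreserving_homeomorphUnitSphereProd
  rw [finrank_euclideanSpace_fin] at h
  have e := h.lintegral_comp_emb (Homeomorph.measurableEmbedding _)
    (fun z => f ((z.2 : ℝ) • (z.1 : EuclideanSpace ℝ (Fin n))))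
  have e' := lintegral_subtype_comap (μ := volume)
    (measurableSet_singleton (0 : EuclideanSpace ℝ (Fin n))).compl f
  rw [restrict_compl_singleton] at e'
  rw [← e, ← e']
  refine lintegral_congr fun x => ?_
  congr 1
  have : ‖(x : EuclideanSpace ℝ (Fin n))‖ ≠ 0 := norm_ne_zero_iff.2 x.2
  simp [smul_smul, this]

theorem lintegral_eq_lintegral_sphere_lintegral {n : ℕ} (hn : 0 < n)
    {f : EuclideanSpace ℝ (Fin n) → ℝ≥0∞} (hf : Measurable f) :
    ∫⁻ x, f x = ∫⁻ ω, (∫⁻ r in Set.Ioi (0 : ℝ), ENNReal.ofReal (r ^ (n - 1)) *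
      f (r • (ω : EuclideanSpace ℝ (Fin n))))
      ∂(volume : Measure (EuclideanSpace ℝ (Fin n))).toSphere := by
  rw [lintegral_eq_lintegral_sphere_prod hn f, lintegral_prod _ (by fun_prop)]
  congr with ω
  rw [Measure.volumeIoiPow, lintegral_withDensity_eq_lintegral_mul _ (by fun_prop) (by fun_prop),
    ← lintegral_subtype_comap measurableSet_Ioi]
  rfl

theorem lintegral_eq_lintegral_lintegral_sphere {n : ℕ} (hn : 0 < n)
    {f : EuclideanSpace ℝ (Fin n) → ℝ≥0∞} (hf : Measurable f) :
    ∫⁻ x, f x = ∫⁻ r in Set.Ioi (0 : ℝ), ENNReal.ofReal (r ^ (n - 1)) *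
      (∫⁻ ω, f (r • (ω : EuclideanSpace ℝ (Fin n)))
      ∂(volume : Measure (EuclideanSpace ℝ (Fin n))).toSphere) := by
  rw [lintegral_eq_lintegral_sphere_lintegral hn hf, lintegral_lintegral_swap]
  · congr with r
    rw [lintegral_const_mul _ (by fun_prop)]
  · apply Measurable.aemeasurable
    fun_prop

theorem enorm_sq_smul_le_lintegral_Ioi {n : ℕ} (hn : 3 ≤ n) {h : EuclideanSpace ℝ (Fin n) → ℝ}
    (hh : ContDiff ℝ (⊤ : ℕ∞) h) (hc : HasCompactSupport h) {ω : EuclideanSpace ℝ (Fin n)}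
    (hω : ‖ω‖ = 1) {r : ℝ} (hr : 0 < r) :
    ‖h (r • ω)‖ₑ ^ 2 ≤ ENNReal.ofReal (r ^ (-((n:ℝ) - 2) / 2) / (((n:ℝ) - 2) / 2)) *
      ∫⁻ s in Set.Ioi r, ENNReal.ofReal (s ^ (n - 1)) * (ENNReal.ofReal (s ^ (-((n:ℝ) - 2) / 2)) *
        ‖fderiv ℝ h (s • ω)‖ₑ ^ 2) := by
  have hn' : (3:ℝ) ≤ n := by exact_mod_cast hn
  have hdiff : Differentiable ℝ h := hh.differentiable (by simp)
  have hcf : Continuous (fderiv ℝ h) := hh.continuous_fderiv (by simp)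
  have hd : ∀ s : ℝ, HasDerivAt (fun s : ℝ => h (s • ω)) (fderiv ℝ h (s • ω) ω) s := fun s => by
    have h1 : HasDerivAt (fun s : ℝ => s • ω) ω s := by
      simpa using (hasDerivAt_id s).smul_const ω
    exact (hdiff (s • ω)).hasFDerivAt.comp_hasDerivAt s h1
  have hcs : HasCompactSupport (fun s : ℝ => h (s • ω)) := by
    have : Topology.IsClosedEmbedding (fun s : ℝ => s • ω) :=
      isClosedEmbedding_smul_left (by rintro rfl; simp at hω)
    exact hc.comp_isClosedEmbedding this
  have h1 : h (r • ω) = - ∫ s in Set.Ioi r, fderiv ℝ h (s • ω) ω := by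
    have h1c : ContDiff ℝ 1 (fun s : ℝ => h (s • ω)) :=
      (hh.of_le (by simp)).comp (contDiff_id.smul contDiff_const)
    have := hcs.integral_Ioi_deriv_eq h1c r
    rw [show (deriv fun s : ℝ => h (s • ω)) = fun s : ℝ => fderiv ℝ h (s • ω) ω from
      funext fun s => (hd s).deriv] at this
    rw [this, neg_neg]
  have h2 : ‖h (r • ω)‖ₑ ≤ ∫⁻ s in Set.Ioi r, ENNReal.ofReal (s ^ (-(n:ℝ) / 4)) *
      (ENNReal.ofReal (s ^ ((n:ℝ) / 4)) * ‖fderiv ℝ h (s • ω)‖ₑ) := by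
    rw [h1, enorm_neg]
    refine (enorm_integral_le_lintegral_enorm _).trans
      (setLIntegral_mono' measurableSet_Ioi fun s hs => ?_)
    have hs0 : 0 < s := hr.trans hs
    rw [← mul_assoc, ← ENNReal.ofReal_mul (by positivity), ← Real.rpow_add hs0, neg_div,
      neg_add_cancel, Real.rpow_zero, ENNReal.ofReal_one, one_mul, ← ofReal_norm, ← ofReal_norm]
    apply ENNReal.ofReal_le_ofReal
    simpa [hω] using (fderiv ℝ h (s • ω)).le_opNorm ω
  have h3 : ∫⁻ s in Set.Ioi r, ENNReal.ofReal (s ^ (-(n:ℝ) / 4)) ^ 2 =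
      ENNReal.ofReal (r ^ (-((n:ℝ) - 2) / 2) / (((n:ℝ) - 2) / 2)) := by
    have e : (-(n:ℝ) / 2 + 1) = -((n:ℝ) - 2) / 2 := by ring
    have hlt : (-(n:ℝ) / 2) < -1 := by linarith
    have := integral_Ioi_rpow_of_lt hlt hr
    rw [e, show -r ^ (-((n:ℝ) - 2) / 2) / (-((n:ℝ) - 2) / 2) =
      r ^ (-((n:ℝ) - 2) / 2) / (((n:ℝ) - 2) / 2) by rw [neg_div _ ((n:ℝ) - 2), neg_div_neg_eq]]
      at this
    rw [← this, ofReal_integral_eq_lintegral_ofReal (integrableOn_Ioi_rpow_of_lt hlt hr)]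
    · refine setLIntegral_congr_fun measurableSet_Ioi fun s hs => ?_
      have hs0 : 0 < s := hr.trans hs
      rw [← ENNReal.ofReal_pow (by positivity), ← Real.rpow_mul_natCast hs0.le]
      congr 2
      push_cast; ring
    · filter_upwards [ae_restrict_mem measurableSet_Ioi] with s hs
      have hs0 : 0 < s := hr.trans hs
      positivity
  calc ‖h (r • ω)‖ₑ ^ 2 ≤ _ ^ 2 := by gcongr
    _ ≤ _ := lintegral_mul_sq_le _ (by fun_prop) (by fun_prop)
    _ = _ := by
      rw [h3]
      congr 1
      refine setLIntegral_congr_fun measurableSet_Ioi fun s hs => ?_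
      have hs0 : 0 < s := hr.trans hs
      rw [mul_pow, ← mul_assoc, ← ENNReal.ofReal_pow (by positivity),
        ← ENNReal.ofReal_mul (by positivity), ← Real.rpow_mul_natCast hs0.le, ← Real.rpow_natCast s,
        ← Real.rpow_add hs0]
      congr 3
      rw [Nat.cast_sub (by omega)]
      push_cast; ring

theorem contDiff_pd {n : ℕ} (i : Fin n) {f : EuclideanSpace ℝ (Fin n) → ℝ}
    (hf : ContDiff ℝ (⊤ : ℕ∞) f) : ContDiff ℝ (⊤ : ℕ∞) (pd n i f) :=
  (hf.fderiv_right (m := (⊤ : ℕ∞)) (by simp)).clm_apply contDiff_const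

theorem contDiff_rot {n : ℕ} (i j : Fin n) {f : EuclideanSpace ℝ (Fin n) → ℝ}
    (hf : ContDiff ℝ (⊤ : ℕ∞) f) : ContDiff ℝ (⊤ : ℕ∞) (rot n i j f) := by
  have := contDiff_pd i hf
  have := contDiff_pd j hf
  unfold rot
  fun_prop

theorem contDiff_rotWord {n l : ℕ} (w : Fin l → Fin n × Fin n) {f : EuclideanSpace ℝ (Fin n) → ℝ}
    (hf : ContDiff ℝ (⊤ : ℕ∞) f) : ContDiff ℝ (⊤ : ℕ∞) (rotWord n w f) := by
  unfold rotWord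
  induction List.ofFn w with
  | nil => exact hf
  | cons p L ih => exact contDiff_rot _ _ ih

theorem rot_neg {n : ℕ} (i j : Fin n) (f : EuclideanSpace ℝ (Fin n) → ℝ) :
    rot n i j (-f) = -rot n i j f := by
  ext x
  simp only [rot, pd, fderiv_neg, Pi.neg_apply, neg_apply]
  ring

theorem rot_swap {n : ℕ} (i j : Fin n) (f : EuclideanSpace ℝ (Fin n) → ℝ) :
    rot n i j f = -rot n j i f := by
  ext x
  simp [rot]

theorem rotWord_neg {n l : ℕ} (w : Fin l → Fin n × Fin n) (f : EuclideanSpace ℝ (Fin n) → ℝ) :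
    rotWord n w (-f) = -rotWord n w f := by
  unfold rotWord
  induction List.ofFn w with
  | nil => rfl
  | cons p L ih => simp [ih, rot_neg]

theorem rotWord_snoc {n l : ℕ} (w : Fin l → Fin n × Fin n) (p : Fin n × Fin n)
    (f : EuclideanSpace ℝ (Fin n) → ℝ) :
    rotWord n (Fin.snoc w p : Fin (l + 1) → Fin n × Fin n) f = rotWord n w (rot n p.1 p.2 f) := by
  rw [rotWord, List.ofFn_succ']
  simp [rotWord]

/-- The sum of `|Ω^w f|` over the words `w` of length at most `k`. -/
noncomputable def rotSum (n k : ℕ) (f : EuclideanSpace ℝ (Fin n) → ℝ)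
    (x : EuclideanSpace ℝ (Fin n)) : ℝ :=
  ∑ l ∈ Finset.range (k + 1), ∑ w ∈ rotWords n l, |rotWord n w f x|

theorem rotSum_nonneg {n k : ℕ} {f : EuclideanSpace ℝ (Fin n) → ℝ}
    {x : EuclideanSpace ℝ (Fin n)} : 0 ≤ rotSum n k f x := by
  unfold rotSum
  positivity

theorem rotSum_mono {n : ℕ} {f : EuclideanSpace ℝ (Fin n) → ℝ}
    {x : EuclideanSpace ℝ (Fin n)} : Monotone fun k => rotSum n k f x := fun k k' hk =>
  Finset.sum_le_sum_of_subset_of_nonneg (Finset.range_subset_range.2 (by omega))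
    fun _ _ _ => by positivity

theorem continuous_rotSum {n : ℕ} (k : ℕ) {f : EuclideanSpace ℝ (Fin n) → ℝ}
    (hf : ContDiff ℝ (⊤ : ℕ∞) f) : Continuous (rotSum n k f) := by
  unfold rotSum
  have := fun l (w : Fin l → Fin n × Fin n) => (contDiff_rotWord w hf).continuous
  fun_prop

theorem rotSum_zero {n : ℕ} (f : EuclideanSpace ℝ (Fin n) → ℝ) (x : EuclideanSpace ℝ (Fin n)) :
    rotSum n 0 f x = |f x| := by
  simp [rotSum, rotWords, rotWord]

theorem rotSum_rot_le {n k : ℕ} (i j : Fin n) (f : EuclideanSpace ℝ (Fin n) → ℝ)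
    (x : EuclideanSpace ℝ (Fin n)) : rotSum n k (rot n i j f) x ≤ rotSum n (k + 1) f x := by
  have main : ∀ i j : Fin n, i < j → rotSum n k (rot n i j f) x ≤ rotSum n (k + 1) f x := by
    intro i j hij
    unfold rotSum
    rw [Finset.sum_range_succ' _ (k + 1)]
    refine le_add_of_le_of_nonneg (Finset.sum_le_sum fun l _ => ?_) (by positivity)
    simp_rw [← rotWord_snoc _ (i, j) f]
    rw [← Finset.sum_image (s := rotWords n l) (f := fun w => |rotWord n w f x|)
      (g := fun w => (Fin.snoc w (i, j) : Fin (l + 1) → Fin n × Fin n))]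
    · refine Finset.sum_le_sum_of_subset_of_nonneg ?_ fun _ _ _ => by positivity
      intro w hw
      obtain ⟨v, hv, rfl⟩ := Finset.mem_image.1 hw
      simp only [rotWords, Finset.mem_filter, Finset.mem_univ, true_and] at hv ⊢
      intro a
      refine Fin.lastCases ?_ (fun a => ?_) a
      · simpa using hij
      · simpa using hv a
    · intro v _ w _ h
      exact (Fin.snoc_injective2 h).1
  rcases lt_trichotomy i j with h | h | h
  · exact main i j h
  · have h0 : rot n i j f = -rot n i j f := by
      subst h
      exact rot_swap i i f
    have hw : ∀ l (w : Fin l → Fin n × Fin n), rotWord n w (rot n i j f) x = 0 := fun l w => by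
      have := congrFun (rotWord_neg w (rot n i j f)) x
      rw [← h0, Pi.neg_apply] at this
      linarith
    have : rotSum n k (rot n i j f) x = 0 := by simp [rotSum, hw]
    rw [this]
    exact rotSum_nonneg
  · have e : rotSum n k (rot n i j f) x = rotSum n k (rot n j i f) x := by
      rw [rot_swap]
      simp [rotSum, rotWord_neg]
    rw [e]
    exact main j i h

theorem fderiv_apply_eq_sum_pd {n : ℕ} (f : EuclideanSpace ℝ (Fin n) → ℝ)
    (y x : EuclideanSpace ℝ (Fin n)) : fderiv ℝ f y x = ∑ j, x j * pd n j f y := by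
  have hx : x = ∑ j, x j • EuclideanSpace.single j (1:ℝ) := by
    simpa using ((EuclideanSpace.basisFun (Fin n) ℝ).sum_repr x).symm
  conv_lhs => rw [hx]
  simp [pd]

theorem pd_homogeneous {n : ℕ} (i : Fin n) {f : EuclideanSpace ℝ (Fin n) → ℝ}
    (hf : Differentiable ℝ f) (r : ℝ) {x : EuclideanSpace ℝ (Fin n)} (hx : x ≠ 0) :
    DifferentiableAt ℝ (fun x => f ((r / ‖x‖) • x)) x ∧
    pd n i (fun x => f ((r / ‖x‖) • x)) x =
      ∑ j, x j / ‖x‖ ^ 2 * rot n j i f ((r / ‖x‖) • x) := by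
  have hx0 : ‖x‖ ≠ 0 := norm_ne_zero_iff.2 hx
  have hnorm : HasFDerivAt (fun x : EuclideanSpace ℝ (Fin n) => ‖x‖) (‖x‖⁻¹ • innerSL ℝ x) x := by
    have h := (hasStrictFDerivAt_norm_sq x).hasFDerivAt.sqrt (by positivity)
    simp only [Real.sqrt_sq (norm_nonneg _)] at h
    refine h.congr_fderiv ?_
    rw [← Nat.cast_smul_eq_nsmul ℝ, smul_smul]
    congr 1
    push_cast
    field_simp
  have hdiv : HasFDerivAt (fun x : EuclideanSpace ℝ (Fin n) => r / ‖x‖)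
      (-(r / ‖x‖ ^ 3) • innerSL ℝ x) x := by
    simp only [div_eq_mul_inv]
    refine (((hasDerivAt_inv hx0).comp_hasFDerivAt x hnorm).const_mul r).congr_fderiv ?_
    rw [smul_smul, smul_smul]
    congr 1
    field_simp
  have hsm : HasFDerivAt (fun x : EuclideanSpace ℝ (Fin n) => (r / ‖x‖) • x) _ x :=
    hdiv.smul (hasFDerivAt_id x)
  have hcomp := HasFDerivAt.comp (g := f) (f := fun x : EuclideanSpace ℝ (Fin n) => (r / ‖x‖) • x) x
    (hf ((r / ‖x‖) • x)).hasFDerivAt hsm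
  refine ⟨hcomp.differentiableAt, ?_⟩
  have e : pd n i (fun x => f ((r / ‖x‖) • x)) x = r / ‖x‖ * pd n i f ((r / ‖x‖) • x) -
      r / ‖x‖ ^ 3 * x i * fderiv ℝ f ((r / ‖x‖) • x) x := by
    have : pd n i (fun x => f ((r / ‖x‖) • x)) x = _ := DFunLike.congr_fun hcomp.fderiv _
    rw [this]
    simp [pd, EuclideanSpace.inner_single_right]
    ring
  rw [e, fderiv_apply_eq_sum_pd]
  simp only [rot, PiLp.smul_apply, smul_eq_mul, mul_sub, Finset.sum_sub_distrib]
  congr 1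
  · have : ∀ j, x j / ‖x‖ ^ 2 * (r / ‖x‖ * x j * pd n i f ((r / ‖x‖) • x)) =
      (x j) ^ 2 * (r / ‖x‖ ^ 3 * pd n i f ((r / ‖x‖) • x)) := fun j => by
      field_simp
    simp_rw [this]
    rw [← Finset.sum_mul, ← EuclideanSpace.real_norm_sq_eq]
    field_simp
  · rw [Finset.mul_sum]
    refine Finset.sum_congr rfl fun j _ => ?_
    field_simp

theorem iterate_pd_sum {n : ℕ} (i : Fin n) {ι : Type*} [Fintype ι] (k : ℕ)
    {F : ι → EuclideanSpace ℝ (Fin n) → ℝ} (hF : ∀ j, ContDiff ℝ (⊤ : ℕ∞) (F j)) :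
    (pd n i)^[k] (fun x => ∑ j, F j x) = fun x => ∑ j, (pd n i)^[k] (F j) x := by
  induction k generalizing F with
  | zero => rfl
  | succ k ih =>
    have : pd n i (fun x => ∑ j, F j x) = fun x => ∑ j, pd n i (F j) x := by
      ext x
      simp only [pd]
      rw [fderiv_fun_sum fun j _ => ((hF j).differentiable (by simp)) x]
      simp
    simp only [Function.iterate_succ_apply, this]
    exact ih fun j => contDiff_pd i (hF j)

theorem tsupport_pd_subset {n : ℕ} (i : Fin n) (a : EuclideanSpace ℝ (Fin n) → ℝ) :
    tsupport (pd n i a) ⊆ tsupport a := by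
  refine closure_minimal (fun x hx => ?_) (isClosed_tsupport a)
  by_contra h
  exact hx (by simp [pd, fderiv_of_notMem_tsupport ℝ h])

theorem contDiff_of_forall_mem_tsupport {E : Type*} [NormedAddCommGroup E] [NormedSpace ℝ E]
    {f : E → ℝ} (h : ∀ x ∈ tsupport f, ContDiffAt ℝ (⊤ : ℕ∞) f x) : ContDiff ℝ (⊤ : ℕ∞) f := by
  refine contDiff_iff_contDiffAt.2 fun x => ?_
  by_cases hx : x ∈ tsupport f
  · exact h x hx
  · exact contDiffAt_const.congr_of_eventuallyEq (notMem_tsupport_iff_eventuallyEq.1 hx)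

/-- The function `f` on the sphere of radius `r`, extended to be homogeneous of degree zero and
multiplied by `a`. -/
noncomputable def homExt {n : ℕ} (a : EuclideanSpace ℝ (Fin n) → ℝ) (r : ℝ)
    (f : EuclideanSpace ℝ (Fin n) → ℝ) (x : EuclideanSpace ℝ (Fin n)) : ℝ :=
  a x * f ((r / ‖x‖) • x)

theorem tsupport_homExt_subset {n : ℕ} (a : EuclideanSpace ℝ (Fin n) → ℝ) (r : ℝ)
    (f : EuclideanSpace ℝ (Fin n) → ℝ) : tsupport (homExt a r f) ⊆ tsupport a :=
  tsupport_mul_subset_left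

theorem contDiff_homExt {n : ℕ} {a : EuclideanSpace ℝ (Fin n) → ℝ} (ha : ContDiff ℝ (⊤ : ℕ∞) a)
    (ha0 : (0 : EuclideanSpace ℝ (Fin n)) ∉ tsupport a) (r : ℝ)
    {f : EuclideanSpace ℝ (Fin n) → ℝ} (hf : ContDiff ℝ (⊤ : ℕ∞) f) :
    ContDiff ℝ (⊤ : ℕ∞) (homExt a r f) := by
  refine contDiff_of_forall_mem_tsupport fun x hx => ?_
  have hx0 : x ≠ 0 := fun h => ha0 (h ▸ tsupport_homExt_subset a r f hx)
  have h1 : ContDiffAt ℝ (⊤ : ℕ∞) (fun x : EuclideanSpace ℝ (Fin n) => (r / ‖x‖) • x) x :=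
    (contDiffAt_const.div (contDiffAt_norm ℝ hx0) (norm_ne_zero_iff.2 hx0)).smul contDiffAt_id
  exact ha.contDiffAt.mul (hf.contDiffAt.comp x h1)

/-- Amplitudes appearing in the derivative of a homogeneous extension. -/
noncomputable def homAmp {n : ℕ} (i : Fin n) (a : EuclideanSpace ℝ (Fin n) → ℝ) :
    Option (Fin n) → EuclideanSpace ℝ (Fin n) → ℝ
  | none => pd n i a
  | some j => fun x => a x * (x j / ‖x‖ ^ 2)

/-- Angular functions appearing in the derivative of a homogeneous extension. -/
noncomputable def homRot {n : ℕ} (i : Fin n) (f : EuclideanSpace ℝ (Fin n) → ℝ) :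
    Option (Fin n) → EuclideanSpace ℝ (Fin n) → ℝ
  | none => f
  | some j => rot n j i f

theorem tsupport_homAmp_subset {n : ℕ} (i : Fin n) (a : EuclideanSpace ℝ (Fin n) → ℝ)
    (o : Option (Fin n)) : tsupport (homAmp i a o) ⊆ tsupport a := by
  cases o with
  | none => exact tsupport_pd_subset i a
  | some j => exact tsupport_mul_subset_left

theorem contDiff_homAmp {n : ℕ} (i : Fin n) {a : EuclideanSpace ℝ (Fin n) → ℝ}
    (ha : ContDiff ℝ (⊤ : ℕ∞) a) (ha0 : (0 : EuclideanSpace ℝ (Fin n)) ∉ tsupport a)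
    (o : Option (Fin n)) : ContDiff ℝ (⊤ : ℕ∞) (homAmp i a o) := by
  cases o with
  | none => exact contDiff_pd i ha
  | some j =>
    refine contDiff_of_forall_mem_tsupport fun x hx => ?_
    have hx0 : x ≠ 0 := fun h => ha0 (h ▸ tsupport_homAmp_subset i a (some j) hx)
    have h1 : ContDiffAt ℝ (⊤ : ℕ∞) (fun x : EuclideanSpace ℝ (Fin n) => x j / ‖x‖ ^ 2) x := by
      refine ContDiffAt.div (by fun_prop) (contDiff_norm_sq ℝ).contDiffAt ?_
      simpa using hx0
    exact ha.contDiffAt.mul h1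

theorem contDiff_homRot {n : ℕ} (i : Fin n) {f : EuclideanSpace ℝ (Fin n) → ℝ}
    (hf : ContDiff ℝ (⊤ : ℕ∞) f) (o : Option (Fin n)) : ContDiff ℝ (⊤ : ℕ∞) (homRot i f o) := by
  cases o with
  | none => exact hf
  | some j => exact contDiff_rot j i hf

theorem rotSum_homRot_le {n k : ℕ} (i : Fin n) (f : EuclideanSpace ℝ (Fin n) → ℝ)
    (o : Option (Fin n)) (x : EuclideanSpace ℝ (Fin n)) :
    rotSum n k (homRot i f o) x ≤ rotSum n (k + 1) f x := by
  cases o with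
  | none => exact rotSum_mono k.le_succ
  | some j => exact rotSum_rot_le j i f x

theorem pd_homExt {n : ℕ} (i : Fin n) {a : EuclideanSpace ℝ (Fin n) → ℝ}
    (ha : ContDiff ℝ (⊤ : ℕ∞) a) (ha0 : (0 : EuclideanSpace ℝ (Fin n)) ∉ tsupport a) (r : ℝ)
    {f : EuclideanSpace ℝ (Fin n) → ℝ} (hf : ContDiff ℝ (⊤ : ℕ∞) f) :
    pd n i (homExt a r f) = fun x => ∑ o, homExt (homAmp i a o) r (homRot i f o) x := by
  ext x
  by_cases hx : x = 0
  · have hz : x ∉ tsupport a := hx ▸ ha0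
    have h1 : pd n i (homExt a r f) x = 0 := image_eq_zero_of_notMem_tsupport fun h =>
      hz (tsupport_homExt_subset _ _ _ (tsupport_pd_subset _ _ h))
    rw [h1]
    refine (Finset.sum_eq_zero fun o _ => image_eq_zero_of_notMem_tsupport fun h => ?_).symm
    exact hz (tsupport_homAmp_subset _ _ _ (tsupport_homExt_subset _ _ _ h))
  · obtain ⟨h1, h2⟩ := pd_homogeneous i (hf.differentiable (by simp)) r hx
    have h3 := fderiv_fun_mul ((ha.differentiable (by simp)) x) h1
    have h4 : pd n i (homExt a r f) x = a x * pd n i (fun x => f ((r / ‖x‖) • x)) x +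
        f ((r / ‖x‖) • x) * pd n i a x := DFunLike.congr_fun h3 _
    rw [h4, h2, Fintype.sum_option, add_comm, Finset.mul_sum]
    simp only [homExt, homAmp, homRot]
    congr 1
    · ring
    · exact Finset.sum_congr rfl fun j _ => by ring

theorem exists_iterate_pd_homExt_le {n : ℕ} {K : Set (EuclideanSpace ℝ (Fin n))} (hK : IsCompact K)
    (hK0 : 0 ∉ K) (i : Fin n) (k : ℕ) {a : EuclideanSpace ℝ (Fin n) → ℝ}
    (ha : ContDiff ℝ (⊤ : ℕ∞) a) (haK : tsupport a ⊆ K) :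
    ∃ C : ℝ, 0 ≤ C ∧ ∀ f : EuclideanSpace ℝ (Fin n) → ℝ, ContDiff ℝ (⊤ : ℕ∞) f → ∀ r x,
      |(pd n i)^[k] (homExt a r f) x| ≤
        K.indicator (fun x => C * rotSum n k f ((r / ‖x‖) • x)) x := by
  induction k generalizing a with
  | zero =>
    obtain ⟨C, hC⟩ := hK.exists_bound_of_continuousOn ha.continuous.continuousOn
    refine ⟨max C 0, le_max_right _ _, fun f hf r x => ?_⟩
    by_cases hx : x ∈ K
    · rw [Set.indicator_of_mem hx, rotSum_zero, Function.iterate_zero_apply, homExt, abs_mul]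
      gcongr
      exact (hC x hx).trans (le_max_left _ _)
    · rw [Set.indicator_of_notMem hx, Function.iterate_zero_apply, homExt,
        image_eq_zero_of_notMem_tsupport fun h => hx (haK h)]
      simp
  | succ k ih =>
    have ha0 : (0 : EuclideanSpace ℝ (Fin n)) ∉ tsupport a := fun h => hK0 (haK h)
    choose C hC0 hC using fun o => ih (contDiff_homAmp i ha ha0 o)
      ((tsupport_homAmp_subset i a o).trans haK)
    refine ⟨∑ o, C o, Finset.sum_nonneg fun o _ => hC0 o, fun f hf r x => ?_⟩
    rw [Function.iterate_succ_apply, pd_homExt i ha ha0 r hf, iterate_pd_sum i k fun o =>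
      contDiff_homExt (contDiff_homAmp i ha ha0 o)
        (fun h => ha0 (tsupport_homAmp_subset i a o h)) r (contDiff_homRot i hf o)]
    refine (Finset.abs_sum_le_sum_abs _ _).trans ?_
    refine (Finset.sum_le_sum fun o _ => hC o _ (contDiff_homRot i hf o) r x).trans ?_
    by_cases hx : x ∈ K
    · simp only [Set.indicator_of_mem hx]
      rw [Finset.sum_mul]
      gcongr with o
      · exact hC0 o
      · exact rotSum_homRot_le i f o _
    · simp [Set.indicator_of_notMem hx]

theorem exists_radial_bump (n : ℕ) : ∃ a : EuclideanSpace ℝ (Fin n) → ℝ,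
    ContDiff ℝ (⊤ : ℕ∞) a ∧ tsupport a ⊆ {x | 1 / 2 ≤ ‖x‖ ∧ ‖x‖ ≤ 2} ∧ ∀ x, ‖x‖ = 1 → a x = 1 := by
  obtain ⟨b, hb, -, hbd, -, hb1⟩ := exists_contDiff_tsupport_subset (n := (⊤ : ℕ∞))
    (Icc_mem_nhds (by norm_num : (1 / 4 : ℝ) < 1) (by norm_num : (1:ℝ) < 4))
  refine ⟨fun x => b (‖x‖ ^ 2), hbd.comp (contDiff_norm_sq ℝ), fun x hx => ?_, fun x hx => ?_⟩
  · have h := hb (tsupport_comp_subset_preimage b (f := fun x : EuclideanSpace ℝ (Fin n) => ‖x‖ ^ 2)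
      (by fun_prop) hx)
    constructor
    · nlinarith [h.1, norm_nonneg x]
    · nlinarith [h.2, norm_nonneg x]
  · simp [hx, hb1]

theorem exists_enorm_sq_le_lintegral_sphere {n m : ℕ} (hn : 0 < n) (hnm : n < 2 * m) :
    ∃ C : ℝ≥0∞, C ≠ ⊤ ∧ ∀ f : EuclideanSpace ℝ (Fin n) → ℝ, ContDiff ℝ (⊤ : ℕ∞) f →
      ∀ (r : ℝ) (ω : EuclideanSpace ℝ (Fin n)), ‖ω‖ = 1 →
      ‖f (r • ω)‖ₑ ^ 2 ≤ C * ∫⁻ ω', ENNReal.ofReal (rotSum n m f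
        (r • (ω' : EuclideanSpace ℝ (Fin n)))) ^ 2
          ∂(volume : Measure (EuclideanSpace ℝ (Fin n))).toSphere := by
  obtain ⟨a, ha, haK, ha1⟩ := exists_radial_bump n
  set K : Set (EuclideanSpace ℝ (Fin n)) := {x | 1 / 2 ≤ ‖x‖ ∧ ‖x‖ ≤ 2} with hKdef
  have hKc : IsClosed K := (isClosed_le continuous_const continuous_norm).inter
    (isClosed_le continuous_norm continuous_const)
  have hK : IsCompact K := Metric.isCompact_of_isClosed_isBounded hKc
    (Metric.isBounded_closedBall.subset fun x hx => mem_closedBall_zero_iff.2 hx.2)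
  have hK0 : (0 : EuclideanSpace ℝ (Fin n)) ∉ K := fun h => by
    have := h.1
    norm_num at this
  obtain ⟨A, hA, hS⟩ := exists_enorm_sq_le_iterate_pd hnm
  set V : ℝ≥0∞ := ∫⁻ s in Set.Ioi (0:ℝ), (Set.Iic (2:ℝ)).indicator
    (fun s => ENNReal.ofReal (s ^ (n - 1))) s with hV
  have hVt : V ≠ ⊤ := by
    rw [hV, lintegral_indicator measurableSet_Iic, Measure.restrict_restrict measurableSet_Iic]
    have : IntegrableOn (fun s : ℝ => s ^ (n - 1)) (Set.Icc 0 2) :=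
      ContinuousOn.integrableOn_Icc (by fun_prop)
    exact (this.mono_set fun s hs => ⟨le_of_lt hs.2, hs.1⟩).lintegral_lt_top.ne
  choose B hB0 hB using fun (i : Fin n) => exists_iterate_pd_homExt_le hK hK0 i m ha haK
  obtain ⟨B', hB'0, hB'⟩ := exists_iterate_pd_homExt_le hK hK0 ⟨0, hn⟩ 0 ha haK
  have key : ∀ f : EuclideanSpace ℝ (Fin n) → ℝ, ContDiff ℝ (⊤ : ℕ∞) f → ∀ (r D : ℝ), 0 ≤ D →
      ∀ u : EuclideanSpace ℝ (Fin n) → ℝ,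
      (∀ x, |u x| ≤ K.indicator (fun x => D * rotSum n m f ((r / ‖x‖) • x)) x) →
      ∫⁻ x, ‖u x‖ₑ ^ 2 ≤ ENNReal.ofReal D ^ 2 * V * ∫⁻ ω', ENNReal.ofReal (rotSum n m f
        (r • (ω' : EuclideanSpace ℝ (Fin n)))) ^ 2
          ∂(volume : Measure (EuclideanSpace ℝ (Fin n))).toSphere := by
    intro f hf r D hD u hu
    have hrs := (continuous_rotSum m hf).measurable
    set F : EuclideanSpace ℝ (Fin n) → ℝ≥0∞ := fun x =>
      (Set.Iic (2:ℝ)).indicator (fun _ => ENNReal.ofReal D ^ 2) ‖x‖ *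
        ENNReal.ofReal (rotSum n m f ((r / ‖x‖) • x)) ^ 2 with hF
    have hFm : Measurable F := by
      refine Measurable.mul ?_ (by fun_prop)
      exact (measurable_const.indicator measurableSet_Iic).comp measurable_norm
    calc ∫⁻ x, ‖u x‖ₑ ^ 2 ≤ ∫⁻ x, F x := by
          refine lintegral_mono fun x => ?_
          by_cases hx : x ∈ K
          · have h := hu x
            rw [Set.indicator_of_mem hx] at h
            simp only [hF]
            rw [Set.indicator_of_mem (show ‖x‖ ∈ Set.Iic (2:ℝ) from hx.2), ← mul_pow,
              ← ENNReal.ofReal_mul hD, ← ofReal_norm]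
            gcongr
            exact h
          · have h := hu x
            rw [Set.indicator_of_notMem hx] at h
            have : u x = 0 := abs_eq_zero.1 (le_antisymm h (abs_nonneg _))
            simp [this]
      _ = ∫⁻ s in Set.Ioi (0 : ℝ), ENNReal.ofReal (s ^ (n - 1)) *
          (∫⁻ ω, F (s • (ω : EuclideanSpace ℝ (Fin n)))
            ∂(volume : Measure (EuclideanSpace ℝ (Fin n))).toSphere) :=
          lintegral_eq_lintegral_lintegral_sphere hn hFm
      _ = ∫⁻ s in Set.Ioi (0 : ℝ), (Set.Iic (2:ℝ)).indicator
            (fun s => ENNReal.ofReal (s ^ (n - 1))) s * (ENNReal.ofReal D ^ 2 *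
          ∫⁻ ω', ENNReal.ofReal (rotSum n m f
            (r • (ω' : EuclideanSpace ℝ (Fin n)))) ^ 2
            ∂(volume : Measure (EuclideanSpace ℝ (Fin n))).toSphere) := by
          refine setLIntegral_congr_fun measurableSet_Ioi fun s hs => ?_
          have hs0 : (0:ℝ) < s := hs
          have e : ∀ ω : Metric.sphere (0 : EuclideanSpace ℝ (Fin n)) 1,
              F (s • (ω : EuclideanSpace ℝ (Fin n))) =
              (Set.Iic (2:ℝ)).indicator (fun _ => ENNReal.ofReal D ^ 2) s *
              ENNReal.ofReal (rotSum n m f (r • (ω : EuclideanSpace ℝ (Fin n)))) ^ 2 := by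
            intro ω
            have hω : ‖(ω : EuclideanSpace ℝ (Fin n))‖ = 1 := by simp
            simp only [hF, norm_smul, hω, mul_one, Real.norm_eq_abs, abs_of_pos hs0, smul_smul,
              div_mul_cancel₀ r hs0.ne']
          simp_rw [e]
          rw [lintegral_const_mul _ (by fun_prop)]
          by_cases h2 : s ∈ Set.Iic (2:ℝ)
          · simp only [Set.indicator_of_mem h2]
          · simp [Set.indicator_of_notMem h2]
      _ = _ := by
          rw [lintegral_mul_const _ ((by fun_prop : Measurable fun s : ℝ =>
            ENNReal.ofReal (s ^ (n - 1))).indicator measurableSet_Iic)]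
          ring
  refine ⟨A * (ENNReal.ofReal B' ^ 2 * V + ∑ i, ENNReal.ofReal (B i) ^ 2 * V), ?_,
    fun f hf r ω hω => ?_⟩
  · refine ENNReal.mul_ne_top hA (ENNReal.add_ne_top.2 ⟨?_, ENNReal.sum_ne_top.2 fun i _ => ?_⟩) <;>
    exact ENNReal.mul_ne_top (by simp) hVt
  · have ha0 : (0 : EuclideanSpace ℝ (Fin n)) ∉ tsupport a := fun h => hK0 (haK h)
    have hu : homExt a r f ω = f (r • ω) := by simp [homExt, ha1 ω hω, hω]
    rw [← hu]
    refine (hS _ (contDiff_homExt ha ha0 r hf) (hK.of_isClosed_subset (isClosed_tsupport _)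
      ((tsupport_homExt_subset a r f).trans haK)) ω).trans ?_
    rw [mul_assoc]
    gcongr
    rw [add_mul, Finset.sum_mul]
    gcongr with i
    · refine key f hf r B' hB'0 _ fun x => (hB' f hf r x).trans (Set.indicator_le_indicator ?_)
      gcongr
      exact rotSum_mono (Nat.zero_le m)
    · exact key f hf r (B i) (hB0 i) _ (hB i f hf r)

theorem lintegral_sphere_enorm_sq_le {n : ℕ} (hn : 3 ≤ n) {h : EuclideanSpace ℝ (Fin n) → ℝ}
    (hh : ContDiff ℝ (⊤ : ℕ∞) h) (hc : HasCompactSupport h) {R r : ℝ} (hR : 0 < R) (hr : R ≤ r) :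
    ∫⁻ ω, ‖h (r • (ω : EuclideanSpace ℝ (Fin n)))‖ₑ ^ 2
        ∂(volume : Measure (EuclideanSpace ℝ (Fin n))).toSphere ≤
      ENNReal.ofReal (r ^ (-((n:ℝ) - 2) / 2) / (((n:ℝ) - 2) / 2)) *
        ∫⁻ x in {x : EuclideanSpace ℝ (Fin n) | R < ‖x‖},
          ENNReal.ofReal (‖x‖ ^ (-((n:ℝ) - 2) / 2)) * ‖fderiv ℝ h x‖ₑ ^ 2 := by
  have hcf : Continuous (fderiv ℝ h) := hh.continuous_fderiv (by simp)
  have hS : MeasurableSet {x : EuclideanSpace ℝ (Fin n) | R < ‖x‖} :=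
    (isOpen_lt continuous_const continuous_norm).measurableSet
  have hmeas : Measurable fun x : EuclideanSpace ℝ (Fin n) =>
      ENNReal.ofReal (‖x‖ ^ (-((n:ℝ) - 2) / 2)) * ‖fderiv ℝ h x‖ₑ ^ 2 := by
    have := hcf.measurable
    fun_prop
  rw [← lintegral_indicator hS, lintegral_eq_lintegral_sphere_lintegral (by omega)
    (hmeas.indicator hS), ← lintegral_const_mul' _ _ ENNReal.ofReal_ne_top]
  refine lintegral_mono fun ω => ?_
  have hω : ‖(ω : EuclideanSpace ℝ (Fin n))‖ = 1 := by simp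
  refine (enorm_sq_smul_le_lintegral_Ioi hn hh hc hω (hR.trans_le hr)).trans ?_
  refine mul_le_mul_right ?_ _
  rw [← lintegral_indicator measurableSet_Ioi, ← lintegral_indicator measurableSet_Ioi]
  refine lintegral_mono fun s => ?_
  by_cases hs : s ∈ Set.Ioi r
  · have hs0 : 0 < s := hR.trans_le (hr.trans (le_of_lt hs))
    have hns : ‖s • (ω : EuclideanSpace ℝ (Fin n))‖ = s := by
      rw [norm_smul, hω, mul_one, Real.norm_eq_abs, abs_of_pos hs0]
    rw [Set.indicator_of_mem hs, Set.indicator_of_mem (show s ∈ Set.Ioi (0:ℝ) from hs0),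
      Set.indicator_of_mem (show s • (ω : EuclideanSpace ℝ (Fin n)) ∈ {x | R < ‖x‖} from
        (hr.trans_lt hs).trans_eq hns.symm), hns]
  · rw [Set.indicator_of_notMem hs]
    exact zero_le

theorem isCompact_annulus (n : ℕ) (R : ℝ) :
    IsCompact {x : EuclideanSpace ℝ (Fin n) | R ≤ ‖x‖ ∧ ‖x‖ ≤ 2 * R} :=
  Metric.isCompact_of_isClosed_isBounded
    ((isClosed_le continuous_const continuous_norm).inter
      (isClosed_le continuous_norm continuous_const))
    (Metric.isBounded_closedBall.subset fun _ hx => mem_closedBall_zero_iff.2 hx.2)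

theorem integrableOn_annulus {n : ℕ} {R : ℝ} (hR : 0 < R) (a : ℝ)
    {f : EuclideanSpace ℝ (Fin n) → ℝ} (hf : Continuous f) :
    IntegrableOn (fun x => ‖x‖ ^ a * f x) {x | R ≤ ‖x‖ ∧ ‖x‖ ≤ 2 * R} := by
  refine ContinuousOn.integrableOn_compact (isCompact_annulus n R) ?_
  exact (continuousOn_id.norm.rpow_const fun x hx => Or.inl (hR.trans_le hx.1).ne').mul
    hf.continuousOn

theorem integrableOn_weighted_fderiv {n : ℕ} {R : ℝ} (hR : 0 < R) (a : ℝ)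
    {h : EuclideanSpace ℝ (Fin n) → ℝ} (hh : ContDiff ℝ (⊤ : ℕ∞) h) (hc : HasCompactSupport h) :
    IntegrableOn (fun x => ‖x‖ ^ a * ‖fderiv ℝ h x‖ ^ 2) {x | R < ‖x‖} := by
  have hcf : Continuous (fderiv ℝ h) := hh.continuous_fderiv (by simp)
  have hK : IsCompact ({x : EuclideanSpace ℝ (Fin n) | R ≤ ‖x‖} ∩ tsupport h) :=
    hc.isCompact.inter_left (isClosed_le continuous_const continuous_norm)
  have h1 : IntegrableOn (fun x => ‖x‖ ^ a * ‖fderiv ℝ h x‖ ^ 2)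
      ({x : EuclideanSpace ℝ (Fin n) | R ≤ ‖x‖} ∩ tsupport h) := by
    refine ContinuousOn.integrableOn_compact hK ?_
    exact (continuousOn_id.norm.rpow_const fun x hx => Or.inl (hR.trans_le hx.1).ne').mul
      (by fun_prop)
  refine h1.of_forall_sdiff_eq_zero (isOpen_lt continuous_const continuous_norm).measurableSet
    fun x (hx : R < ‖x‖ ∧ _) => ?_
  have hx' : x ∉ tsupport h := fun hs => hx.2 ⟨hx.1.le, hs⟩
  simp [fderiv_of_notMem_tsupport ℝ hx']

theorem exists_lintegral_annulus_mul_sq_le {n m : ℕ} (hn : 3 ≤ n) (hnm : n < 2 * m) :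
    ∃ C : ℝ≥0∞, C ≠ ⊤ ∧ ∀ g h : EuclideanSpace ℝ (Fin n) → ℝ, ContDiff ℝ (⊤ : ℕ∞) g →
      ContDiff ℝ (⊤ : ℕ∞) h → HasCompactSupport h → ∀ R > (0:ℝ),
      ∫⁻ x in {x : EuclideanSpace ℝ (Fin n) | R ≤ ‖x‖ ∧ ‖x‖ ≤ 2 * R}, ‖g x‖ₑ ^ 2 * ‖h x‖ₑ ^ 2 ≤
        C * (∫⁻ x in {x : EuclideanSpace ℝ (Fin n) | R ≤ ‖x‖ ∧ ‖x‖ ≤ 2 * R},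
          ENNReal.ofReal (‖x‖ ^ (-((n:ℝ) - 2) / 2)) * ENNReal.ofReal (rotSum n m g x) ^ 2) *
        ∫⁻ x in {x : EuclideanSpace ℝ (Fin n) | R < ‖x‖},
          ENNReal.ofReal (‖x‖ ^ (-((n:ℝ) - 2) / 2)) * ‖fderiv ℝ h x‖ₑ ^ 2 := by
  obtain ⟨C, hC, hS⟩ := exists_enorm_sq_le_lintegral_sphere (by omega : 0 < n) hnm
  have hn' : (3:ℝ) ≤ n := by exact_mod_cast hn
  refine ⟨C * ENNReal.ofReal (((n:ℝ) - 2) / 2)⁻¹, ENNReal.mul_ne_top hC ENNReal.ofReal_ne_top,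
    fun g h hg hh hc R hR => ?_⟩
  have hA := (isCompact_annulus n R).measurableSet
  set A : Set (EuclideanSpace ℝ (Fin n)) := {x | R ≤ ‖x‖ ∧ ‖x‖ ≤ 2 * R} with hAdef
  set J := ∫⁻ x in {x : EuclideanSpace ℝ (Fin n) | R < ‖x‖},
    ENNReal.ofReal (‖x‖ ^ (-((n:ℝ) - 2) / 2)) * ‖fderiv ℝ h x‖ₑ ^ 2 with hJ
  have hgm := hg.continuous.measurable
  have hhm := hh.continuous.measurable
  have hrs := (continuous_rotSum m hg).measurable
  have hJt : J ≠ ⊤ := by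
    refine (Eq.trans_lt ?_
      (integrableOn_weighted_fderiv hR (-((n:ℝ) - 2) / 2) hh hc).lintegral_lt_top).ne
    refine lintegral_congr fun x => ?_
    rw [ENNReal.ofReal_mul (by positivity), ENNReal.ofReal_pow (norm_nonneg _), ofReal_norm]
  rw [← lintegral_indicator hA, ← lintegral_indicator hA,
    lintegral_eq_lintegral_lintegral_sphere (by omega) (Measurable.indicator (by fun_prop) hA),
    lintegral_eq_lintegral_lintegral_sphere (by omega) (Measurable.indicator (by fun_prop) hA),
    ← lintegral_const_mul' _ _ (ENNReal.mul_ne_top hC ENNReal.ofReal_ne_top),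
    ← lintegral_mul_const' _ _ hJt]
  refine setLIntegral_mono' measurableSet_Ioi fun r hr => ?_
  have hr0 : (0:ℝ) < r := hr
  have hns : ∀ ω : Metric.sphere (0 : EuclideanSpace ℝ (Fin n)) 1,
      ‖r • (ω : EuclideanSpace ℝ (Fin n))‖ = r := fun ω => by
    simp [norm_smul, abs_of_pos hr0]
  by_cases hrA : R ≤ r ∧ r ≤ 2 * R
  · have hmem : ∀ ω : Metric.sphere (0 : EuclideanSpace ℝ (Fin n)) 1,
        r • (ω : EuclideanSpace ℝ (Fin n)) ∈ A := fun ω => by simpa [hAdef, hns] using hrA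
    simp only [Set.indicator_of_mem (hmem _), hns]
    rw [lintegral_const_mul _ (by fun_prop)]
    set G := ∫⁻ ω, ENNReal.ofReal (rotSum n m g (r • (ω : EuclideanSpace ℝ (Fin n)))) ^ 2
      ∂(volume : Measure (EuclideanSpace ℝ (Fin n))).toSphere with hG
    calc ENNReal.ofReal (r ^ (n - 1)) * ∫⁻ ω, ‖g (r • (ω : EuclideanSpace ℝ (Fin n)))‖ₑ ^ 2 *
          ‖h (r • (ω : EuclideanSpace ℝ (Fin n)))‖ₑ ^ 2
          ∂(volume : Measure (EuclideanSpace ℝ (Fin n))).toSphere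
        ≤ ENNReal.ofReal (r ^ (n - 1)) * ∫⁻ ω, (C * G) *
          ‖h (r • (ω : EuclideanSpace ℝ (Fin n)))‖ₑ ^ 2
          ∂(volume : Measure (EuclideanSpace ℝ (Fin n))).toSphere := by
          gcongr with ω
          exact hS g hg r ω (by simp)
      _ ≤ ENNReal.ofReal (r ^ (n - 1)) * ((C * G) *
          (ENNReal.ofReal (r ^ (-((n:ℝ) - 2) / 2) / (((n:ℝ) - 2) / 2)) * J)) := by
          rw [lintegral_const_mul _ (by fun_prop)]
          gcongr
          exact lintegral_sphere_enorm_sq_le hn hh hc hR hrA.1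
      _ = _ := by
          rw [div_eq_mul_inv (r ^ _), ENNReal.ofReal_mul (by positivity)]
          ring
  · have hmem : ∀ ω : Metric.sphere (0 : EuclideanSpace ℝ (Fin n)) 1,
        r • (ω : EuclideanSpace ℝ (Fin n)) ∉ A := fun ω => by simpa [hAdef, hns] using hrA
    simp [Set.indicator_of_notMem (hmem _)]

theorem rotSum_sq_le (n m : ℕ) (f : EuclideanSpace ℝ (Fin n) → ℝ) (x : EuclideanSpace ℝ (Fin n)) :
    rotSum n m f x ^ 2 ≤ ((Finset.range (m + 1)).sigma (rotWords n)).card *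
      ∑ l ∈ Finset.range (m + 1), ∑ w ∈ rotWords n l, rotWord n w f x ^ 2 := by
  rw [rotSum, Finset.sum_sigma' (Finset.range (m + 1)), Finset.sum_sigma' (Finset.range (m + 1))]
  refine sq_sum_le_card_mul_sum_sq.trans_eq ?_
  simp only [sq_abs]

theorem integral_rotSum_sq_le {n m : ℕ} {R : ℝ} (hR : 0 < R) (a : ℝ)
    {g : EuclideanSpace ℝ (Fin n) → ℝ} (hg : ContDiff ℝ (⊤ : ℕ∞) g) :
    ∫ x in {x : EuclideanSpace ℝ (Fin n) | R ≤ ‖x‖ ∧ ‖x‖ ≤ 2 * R},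
        ‖x‖ ^ a * rotSum n m g x ^ 2 ≤
      ((Finset.range (m + 1)).sigma (rotWords n)).card *
        (∑ l ∈ Finset.range (m + 1), ∑ w ∈ rotWords n l, √(∫ x in
          {x : EuclideanSpace ℝ (Fin n) | R ≤ ‖x‖ ∧ ‖x‖ ≤ 2 * R},
            ‖x‖ ^ a * rotWord n w g x ^ 2)) ^ 2 := by
  have hi : ∀ l, ∀ w : Fin l → Fin n × Fin n, IntegrableOn (fun x => ‖x‖ ^ a * rotWord n w g x ^ 2)
      {x | R ≤ ‖x‖ ∧ ‖x‖ ≤ 2 * R} := fun l w =>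
    integrableOn_annulus hR a ((contDiff_rotWord w hg).continuous.pow 2)
  calc ∫ x in {x : EuclideanSpace ℝ (Fin n) | R ≤ ‖x‖ ∧ ‖x‖ ≤ 2 * R},
        ‖x‖ ^ a * rotSum n m g x ^ 2
      ≤ ∫ x in {x : EuclideanSpace ℝ (Fin n) | R ≤ ‖x‖ ∧ ‖x‖ ≤ 2 * R},
        ((Finset.range (m + 1)).sigma (rotWords n)).card *
        ∑ l ∈ Finset.range (m + 1), ∑ w ∈ rotWords n l, ‖x‖ ^ a * rotWord n w g x ^ 2 := by
        refine setIntegral_mono (integrableOn_annulus hR a ((continuous_rotSum m hg).pow 2))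
          ((integrable_finsetSum _ fun l _ => integrable_finsetSum _ fun w _ =>
            hi l w).const_mul _) fun x => ?_
        refine (mul_le_mul_of_nonneg_left (rotSum_sq_le n m g x) (by positivity)).trans_eq ?_
        simp only [Finset.mul_sum]
        refine Finset.sum_congr rfl fun l _ => Finset.sum_congr rfl fun w _ => by ring
    _ = ((Finset.range (m + 1)).sigma (rotWords n)).card *
        ∑ l ∈ Finset.range (m + 1), ∑ w ∈ rotWords n l, √(∫ x in
          {x : EuclideanSpace ℝ (Fin n) | R ≤ ‖x‖ ∧ ‖x‖ ≤ 2 * R},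
            ‖x‖ ^ a * rotWord n w g x ^ 2) ^ 2 := by
        rw [integral_const_mul, integral_finsetSum _ fun l _ => integrable_finsetSum _ fun w _ =>
          hi l w]
        congr 1
        refine Finset.sum_congr rfl fun l _ => ?_
        rw [integral_finsetSum _ fun w _ => hi l w]
        refine Finset.sum_congr rfl fun w _ => ?_
        rw [Real.sq_sqrt]
        exact integral_nonneg fun x => by positivity
    _ ≤ _ := by
        rw [Finset.sum_sigma' (Finset.range (m + 1)), Finset.sum_sigma' (Finset.range (m + 1))]
        gcongr
        exact Finset.sum_sq_le_sq_sum_of_nonneg fun i _ => Real.sqrt_nonneg _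

end

/-- for `n ≥ 4` there is `C = C(n) > 0` such that for all smooth
compactly supported `g, h` on `ℝⁿ` and all `R > 0`,
`‖gh‖_{L²(R ≤ |x| ≤ 2R)} ≤
 C Σ_{|α| ≤ ⌈(n+1)/2⌉} ‖ |x|^{-(n-2)/4} Ω^α g ‖_{L²(R ≤ |x| ≤ 2R)}
   · ‖ |x|^{-(n-2)/4} ∇h ‖_{L²(|x| > R)}`. -/
theorem product_annulus_bound (n : ℕ) (hn : 4 ≤ n) :
    ∃ C > (0:ℝ), ∀ g h : EuclideanSpace ℝ (Fin n) → ℝ,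
      ContDiff ℝ (⊤ : ℕ∞) g → HasCompactSupport g →
      ContDiff ℝ (⊤ : ℕ∞) h → HasCompactSupport h → ∀ R > (0:ℝ),
      Real.sqrt (∫ x in {x : EuclideanSpace ℝ (Fin n) | R ≤ ‖x‖ ∧ ‖x‖ ≤ 2 * R},
          (g x * h x) ^ 2) ≤
        C * (∑ l ∈ Finset.range ((n + 2) / 2 + 1), ∑ w ∈ rotWords n l,
              Real.sqrt (∫ x in
                  {x : EuclideanSpace ℝ (Fin n) | R ≤ ‖x‖ ∧ ‖x‖ ≤ 2 * R},
                ‖x‖ ^ (-((n:ℝ) - 2) / 2) * (rotWord n w g x) ^ 2)) *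
          Real.sqrt (∫ x in {x : EuclideanSpace ℝ (Fin n) | R < ‖x‖},
            ‖x‖ ^ (-((n:ℝ) - 2) / 2) * ‖fderiv ℝ h x‖ ^ 2) := by
  obtain ⟨C, hC, hCb⟩ := exists_lintegral_annulus_mul_sq_le (by omega : 3 ≤ n)
    (by omega : n < 2 * ((n + 2) / 2))
  set m := (n + 2) / 2
  set N : ℝ := (((Finset.range (m + 1)).sigma (rotWords n)).card : ℝ) with hN
  refine ⟨√(C.toReal * N) + 1, by positivity, fun g h hg _ hh hc R hR => ?_⟩
  set a : ℝ := -((n:ℝ) - 2) / 2 with ha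
  set A : Set (EuclideanSpace ℝ (Fin n)) := {x | R ≤ ‖x‖ ∧ ‖x‖ ≤ 2 * R} with hA
  set S := ∑ l ∈ Finset.range (m + 1), ∑ w ∈ rotWords n l,
    √(∫ x in A, ‖x‖ ^ a * rotWord n w g x ^ 2) with hS
  have hS0 : 0 ≤ S := Finset.sum_nonneg fun l _ => Finset.sum_nonneg fun w _ => Real.sqrt_nonneg _
  set T := ∫ x in A, ‖x‖ ^ a * rotSum n m g x ^ 2 with hT
  set J := ∫ x in {x : EuclideanSpace ℝ (Fin n) | R < ‖x‖}, ‖x‖ ^ a * ‖fderiv ℝ h x‖ ^ 2 with hJ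
  have hT0 : 0 ≤ T := integral_nonneg fun x => by positivity
  have hJ0 : 0 ≤ J := integral_nonneg fun x => by positivity
  have hTS : T ≤ N * S ^ 2 := integral_rotSum_sq_le hR a hg
  have hTe : ENNReal.ofReal T =
      ∫⁻ x in A, ENNReal.ofReal (‖x‖ ^ a) * ENNReal.ofReal (rotSum n m g x) ^ 2 := by
    have hi : IntegrableOn (fun x => ‖x‖ ^ a * rotSum n m g x ^ 2) A :=
      integrableOn_annulus hR a ((continuous_rotSum m hg).pow 2)
    rw [hT, ofReal_integral_eq_lintegral_ofReal hi
      (.of_forall fun x => by positivity)]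
    refine lintegral_congr fun x => ?_
    rw [ENNReal.ofReal_mul (by positivity), ENNReal.ofReal_pow rotSum_nonneg]
  have hJe : ENNReal.ofReal J = ∫⁻ x in {x : EuclideanSpace ℝ (Fin n) | R < ‖x‖},
      ENNReal.ofReal (‖x‖ ^ a) * ‖fderiv ℝ h x‖ₑ ^ 2 := by
    rw [hJ, ofReal_integral_eq_lintegral_ofReal (integrableOn_weighted_fderiv hR a hh hc)
      (.of_forall fun x => by positivity)]
    refine lintegral_congr fun x => ?_
    rw [ENNReal.ofReal_mul (by positivity), ENNReal.ofReal_pow (norm_nonneg _), ofReal_norm]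
  have hI : ∫ x in A, (g x * h x) ^ 2 ≤ C.toReal * T * J := by
    have hb := hCb g h hg hh hc R hR
    rw [← hTe, ← hJe] at hb
    have hgh : Continuous fun x => (g x * h x) ^ 2 := (hg.continuous.mul hh.continuous).pow 2
    rw [integral_eq_lintegral_of_nonneg_ae (.of_forall fun x => by positivity)
      hgh.aestronglyMeasurable]
    refine ENNReal.toReal_le_of_le_ofReal (by positivity) ?_
    rw [ENNReal.ofReal_mul (by positivity), ENNReal.ofReal_mul ENNReal.toReal_nonneg,
      ENNReal.ofReal_toReal hC]
    refine (lintegral_congr fun x => ?_).trans_le hb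
    rw [← mul_pow, ← enorm_mul, Real.enorm_eq_ofReal_abs, ← ENNReal.ofReal_pow (abs_nonneg _),
      sq_abs]
  calc √(∫ x in A, (g x * h x) ^ 2) ≤ √((√(C.toReal * N) * S * √J) ^ 2) := by
        refine Real.sqrt_le_sqrt (hI.trans ?_)
        rw [mul_pow, mul_pow, Real.sq_sqrt (by positivity), Real.sq_sqrt hJ0, mul_assoc C.toReal N]
        gcongr
    _ = √(C.toReal * N) * S * √J := Real.sqrt_sq (by positivity)
    _ ≤ _ := by
        gcongr
        linarith
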